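/- Let (w^n_j) be a solution of the θ-scheme with 0 ≤ B(ξ) ≤ 1 for all ξ ∈ ℝ and with the CFL condition λ(1−θ) < 1/2, λ = Δt/(Δx)², and let w^{Δt} : [0,1] × [0,∞) → ℝ be its space–time interpolation, piecewise linear in x and piecewise constant in t: w^{Δt}(x,t) = ((x_{j+1} − x)/Δx) w^n_j + ((x − x_j)/Δx) w^n_{j+1} for x ∈ [x_j, x_{j+1}), t ∈ [nΔt, (n+1)Δt). Set z^0_j = (w^0_{j+1} − w^0_j)/Δx. Then for all t ≥ 0 and τ ≥ 0, ∫₀¹ |w^{Δt}(x, t+τ) − w^{Δt}(x, t)| dx ≤ (τ + Δt) ∑_{j ∈ ZMod N} |z^0_{j+1} − z^0_j| + (Δx/2) ∑_{j ∈ ZMod N} |w^0_{j+1} − w^0_j|. -/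

import Mathlib

set_option autoImplicit false

/-- Grid spacing `Δx = 1/N` on the periodic domain `[0,1]`. -/
noncomputable def gridDx (N : ℕ) : ℝ := 1 / N

/-- `(w n j)` is a solution of the θ-scheme `D_t^+ w^n_j = B(w^{n+θ}_j) D² w^{n+θ}_j`
for `w_t = B(w) w_xx` on a periodic grid of `N` cells, where
`w^{n+θ}_j = θ w^{n+1}_j + (1-θ) w^n_j` and
`D² a_j = (a_{j+1} - 2 a_j + a_{j-1})/(Δx)²`. -/
def IsThetaScheme (N : ℕ) (θ Δt : ℝ) (B : ℝ → ℝ) (w : ℕ → ZMod N → ℝ) : Prop :=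
  ∀ (n : ℕ) (j : ZMod N),
    (w (n + 1) j - w n j) / Δt =
      B (θ * w (n + 1) j + (1 - θ) * w n j) *
        (((θ * w (n + 1) (j + 1) + (1 - θ) * w n (j + 1))
          - 2 * (θ * w (n + 1) j + (1 - θ) * w n j)
          + (θ * w (n + 1) (j - 1) + (1 - θ) * w n (j - 1))) / (gridDx N) ^ 2)

open Finset in
/-- The `ℓ¹` norm does not increase along a θ-step of `d_t = (b d)_xx` whose explicit weights `q`
are at most `1/2`. -/
theorem sum_abs_le_of_theta_step {N : ℕ} [NeZero N] (p q d d' : ZMod N → ℝ)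
    (hp : ∀ j, 0 ≤ p j) (hq : ∀ j, 0 ≤ q j) (hq2 : ∀ j, q j ≤ 1 / 2)
    (h : ∀ j, (1 + 2 * p j) * d' j = (1 - 2 * q j) * d j
      + (p (j + 1) * d' (j + 1) + p (j - 1) * d' (j - 1))
      + (q (j + 1) * d (j + 1) + q (j - 1) * d (j - 1))) :
    ∑ j, |d' j| ≤ ∑ j, |d j| := by
  have key : ∀ j, |d' j| + 2 * (p j * |d' j|) ≤ |d j| - 2 * (q j * |d j|)
      + (p (j + 1) * |d' (j + 1)| + p (j - 1) * |d' (j - 1)|)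
      + (q (j + 1) * |d (j + 1)| + q (j - 1) * |d (j - 1)|) := by
    intro j
    have e := congrArg abs (h j)
    rw [abs_mul, abs_of_nonneg (by linarith [hp j])] at e
    have h1 : |(1 - 2 * q j) * d j| = (1 - 2 * q j) * |d j| := by
      rw [abs_mul, abs_of_nonneg (by linarith [hq2 j])]
    have hP : ∀ i, |p i * d' i| = p i * |d' i| := fun i => by rw [abs_mul, abs_of_nonneg (hp i)]
    have hQ : ∀ i, |q i * d i| = q i * |d i| := fun i => by rw [abs_mul, abs_of_nonneg (hq i)]
    have t1 := abs_add_three ((1 - 2 * q j) * d j)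
      (p (j + 1) * d' (j + 1) + p (j - 1) * d' (j - 1))
      (q (j + 1) * d (j + 1) + q (j - 1) * d (j - 1))
    have t2 := abs_add_le (p (j + 1) * d' (j + 1)) (p (j - 1) * d' (j - 1))
    have t3 := abs_add_le (q (j + 1) * d (j + 1)) (q (j - 1) * d (j - 1))
    rw [hP, hP] at t2
    rw [hQ, hQ] at t3
    linarith
  have hs := sum_le_sum fun j (_ : j ∈ univ) => key j
  have up (f : ZMod N → ℝ) : ∑ j, f (j + 1) = ∑ j, f j := Equiv.sum_comp (Equiv.addRight 1) f
  have dn (f : ZMod N → ℝ) : ∑ j, f (j - 1) = ∑ j, f j := Equiv.sum_comp (Equiv.subRight 1) f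
  simp only [sum_add_distrib, sum_sub_distrib, ← mul_sum] at hs
  rw [up fun j => p j * |d' j|, dn fun j => p j * |d' j|, up fun j => q j * |d j|,
    dn fun j => q j * |d j|] at hs
  linarith

/-- The undivided second difference of a periodic grid function. -/
def secondDiff {N : ℕ} (a : ZMod N → ℝ) (j : ZMod N) : ℝ := a (j + 1) - 2 * a j + a (j - 1)

section ThetaScheme

variable {N : ℕ} {θ Δt : ℝ} {B : ℝ → ℝ} {w : ℕ → ZMod N → ℝ}

theorem IsThetaScheme.step (hw : IsThetaScheme N θ Δt B w) (hΔt : 0 < Δt) (n : ℕ) (j : ZMod N) :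
    w (n + 1) j - w n j = Δt / gridDx N ^ 2 * B (θ * w (n + 1) j + (1 - θ) * w n j)
      * (θ * secondDiff (w (n + 1)) j + (1 - θ) * secondDiff (w n) j) := by
  have h := hw n j
  rw [div_eq_iff hΔt.ne'] at h
  rw [h, secondDiff, secondDiff]
  ring

theorem IsThetaScheme.sum_abs_secondDiff_succ_le [NeZero N] (hw : IsThetaScheme N θ Δt B w)
    (hθ0 : 0 ≤ θ) (hθ1 : θ ≤ 1) (hΔt : 0 < Δt) (hB0 : ∀ ξ, 0 ≤ B ξ) (hB1 : ∀ ξ, B ξ ≤ 1)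
    (hCFL : Δt / gridDx N ^ 2 * (1 - θ) < 1 / 2) (n : ℕ) :
    ∑ j, |secondDiff (w (n + 1)) j| ≤ ∑ j, |secondDiff (w n) j| := by
  set L := Δt / gridDx N ^ 2 with hL
  have hL0 : 0 ≤ L := by positivity
  have hθ' : 0 ≤ 1 - θ := by linarith
  set b : ZMod N → ℝ := fun j => B (θ * w (n + 1) j + (1 - θ) * w n j) with hb
  have hb0 : ∀ j, 0 ≤ b j := fun j => hB0 _
  have hb1 : ∀ j, b j ≤ 1 := fun j => hB1 _
  refine sum_abs_le_of_theta_step (fun j => L * θ * b j) (fun j => L * (1 - θ) * b j) _ _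
    (fun j => mul_nonneg (mul_nonneg hL0 hθ0) (hb0 j))
    (fun j => mul_nonneg (mul_nonneg hL0 hθ') (hb0 j))
    (fun j => (mul_le_of_le_one_right (mul_nonneg hL0 hθ') (hb1 j)).trans hCFL.le) fun j => ?_
  have s : ∀ i, w (n + 1) i - w n i = L * b i
      * (θ * secondDiff (w (n + 1)) i + (1 - θ) * secondDiff (w n) i) := hw.step hΔt n
  have e : secondDiff (w (n + 1)) j - secondDiff (w n) j
      = (w (n + 1) (j + 1) - w n (j + 1)) - 2 * (w (n + 1) j - w n j)
        + (w (n + 1) (j - 1) - w n (j - 1)) := by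
    rw [secondDiff, secondDiff]; ring
  rw [s, s, s] at e
  linear_combination e

theorem IsThetaScheme.sum_abs_secondDiff_le [NeZero N] (hw : IsThetaScheme N θ Δt B w)
    (hθ0 : 0 ≤ θ) (hθ1 : θ ≤ 1) (hΔt : 0 < Δt) (hB0 : ∀ ξ, 0 ≤ B ξ) (hB1 : ∀ ξ, B ξ ≤ 1)
    (hCFL : Δt / gridDx N ^ 2 * (1 - θ) < 1 / 2) (n : ℕ) :
    ∑ j, |secondDiff (w n) j| ≤ ∑ j, |secondDiff (w 0) j| :=
  antitone_nat_of_succ_le (f := fun n => ∑ j, |secondDiff (w n) j|)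
    (hw.sum_abs_secondDiff_succ_le hθ0 hθ1 hΔt hB0 hB1 hCFL) n.zero_le

theorem IsThetaScheme.sum_abs_succ_sub_le [NeZero N] (hw : IsThetaScheme N θ Δt B w)
    (hθ0 : 0 ≤ θ) (hθ1 : θ ≤ 1) (hΔt : 0 < Δt) (hB0 : ∀ ξ, 0 ≤ B ξ) (hB1 : ∀ ξ, B ξ ≤ 1)
    (hCFL : Δt / gridDx N ^ 2 * (1 - θ) < 1 / 2) (n : ℕ) :
    ∑ j, |w (n + 1) j - w n j| ≤ Δt / gridDx N ^ 2 * ∑ j, |secondDiff (w 0) j| := by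
  have hL0 : 0 ≤ Δt / gridDx N ^ 2 := by positivity
  have hθ' : 0 ≤ 1 - θ := by linarith
  have hT := hw.sum_abs_secondDiff_le hθ0 hθ1 hΔt hB0 hB1 hCFL
  calc ∑ j, |w (n + 1) j - w n j|
      ≤ ∑ j, Δt / gridDx N ^ 2
          * (θ * |secondDiff (w (n + 1)) j| + (1 - θ) * |secondDiff (w n) j|) := by
        refine Finset.sum_le_sum fun j _ => ?_
        rw [hw.step hΔt n j, abs_mul, abs_of_nonneg (mul_nonneg hL0 (hB0 _))]
        refine mul_le_mul (mul_le_of_le_one_right hL0 (hB1 _)) ?_ (abs_nonneg _) hL0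
        refine (abs_add_le _ _).trans_eq ?_
        rw [abs_mul, abs_mul, abs_of_nonneg hθ0, abs_of_nonneg hθ']
    _ ≤ _ := by
        rw [← Finset.mul_sum, Finset.sum_add_distrib, ← Finset.mul_sum, ← Finset.mul_sum]
        refine mul_le_mul_of_nonneg_left ?_ hL0
        nlinarith [mul_le_mul_of_nonneg_left (hT (n + 1)) hθ0,
          mul_le_mul_of_nonneg_left (hT n) hθ']

theorem IsThetaScheme.sum_abs_add_sub_le [NeZero N] (hw : IsThetaScheme N θ Δt B w)
    (hθ0 : 0 ≤ θ) (hθ1 : θ ≤ 1) (hΔt : 0 < Δt) (hB0 : ∀ ξ, 0 ≤ B ξ) (hB1 : ∀ ξ, B ξ ≤ 1)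
    (hCFL : Δt / gridDx N ^ 2 * (1 - θ) < 1 / 2) (n m : ℕ) :
    ∑ j, |w (n + m) j - w n j| ≤ m * (Δt / gridDx N ^ 2 * ∑ j, |secondDiff (w 0) j|) := by
  induction m with
  | zero => simp
  | succ m ih =>
    have h := hw.sum_abs_succ_sub_le hθ0 hθ1 hΔt hB0 hB1 hCFL (n + m)
    have h2 : ∑ j, |w (n + (m + 1)) j - w n j|
        ≤ ∑ j, |w (n + m + 1) j - w (n + m) j| + ∑ j, |w (n + m) j - w n j| := by
      rw [← Finset.sum_add_distrib]
      exact Finset.sum_le_sum fun j _ => abs_sub_le _ _ _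
    push_cast
    linarith

end ThetaScheme

theorem ZMod.sum_natCast_range {M : Type*} [AddCommMonoid M] {N : ℕ} [NeZero N]
    (f : ZMod N → M) : ∑ k ∈ Finset.range N, f (k : ZMod N) = ∑ j, f j :=
  Finset.sum_nbij' (fun k => (k : ZMod N)) ZMod.val (by simp)
    (fun j _ => Finset.mem_range.2 j.val_lt)
    (fun k hk => ZMod.val_natCast_of_lt (Finset.mem_range.1 hk)) (by simp) (by simp)

open MeasureTheory in
/-- A function that interpolates `a` linearly on each grid cell has `L¹` norm at most that of the
grid function. -/
theorem integral_abs_le_of_piecewise_linear {N : ℕ} [NeZero N] (a : ZMod N → ℝ) (f : ℝ → ℝ)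
    (hf : ∀ (j : ZMod N), ∀ x ∈ Set.Ico ((j.val : ℝ) / N) (((j.val : ℝ) + 1) / N),
      f x = ((((j.val : ℝ) + 1) / N - x) * N) * a j + ((x - (j.val : ℝ) / N) * N) * a (j + 1)) :
    ∫ x in (0 : ℝ)..1, |f x| ≤ (1 / N) * ∑ j, |a j| := by
  have hN : (0 : ℝ) < N := by exact_mod_cast NeZero.pos N
  have hle : ∀ k : ℕ, (k : ℝ) / N ≤ ((k : ℝ) + 1) / N := fun k => by gcongr; linarith
  set g : ℕ → ℝ → ℝ := fun k x =>
    ((((k : ℝ) + 1) / N - x) * N) * a k + ((x - (k : ℝ) / N) * N) * a (k + 1) with hg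
  have hfg : ∀ k < N, ∀ x ∈ Set.Ioo ((k : ℝ) / N) (((k : ℝ) + 1) / N), |f x| = |g k x| := by
    intro k hk x hx
    have h := hf (k : ZMod N) x
    rw [ZMod.val_natCast_of_lt hk] at h
    rw [h ⟨hx.1.le, hx.2⟩]
  have hgc : ∀ k, Continuous fun x => |g k x| := fun k => by simp only [hg]; fun_prop
  have hint : ∀ k < N, IntervalIntegrable (fun x => |f x|) volume
      ((k : ℝ) / N) (((k + 1 : ℕ) : ℝ) / N) := by
    intro k hk
    rw [Nat.cast_succ]
    refine ((hgc k).intervalIntegrable _ _).congr_uIoo fun x hx => ?_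
    rw [Set.uIoo_of_le (hle k)] at hx
    exact (hfg k hk x hx).symm
  have hcell : ∀ k < N, ∫ x in ((k : ℝ) / N)..(((k + 1 : ℕ) : ℝ) / N), |f x|
      ≤ (1 / N) * ((|a k| + |a (k + 1)|) / 2) := by
    intro k hk
    have hi := hint k hk
    rw [Nat.cast_succ] at hi ⊢
    calc ∫ x in ((k : ℝ) / N)..(((k : ℝ) + 1) / N), |f x|
        ≤ ∫ x in ((k : ℝ) / N)..(((k : ℝ) + 1) / N),
            (((((k : ℝ) + 1) / N - x) * N) * |a k| + ((x - (k : ℝ) / N) * N) * |a (k + 1)|) := by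
          refine intervalIntegral.integral_mono_on_of_le_Ioo (hle k) hi
            (Continuous.intervalIntegrable (by fun_prop) _ _) fun x hx => ?_
          rw [hfg k hk x hx]
          refine (abs_add_le _ _).trans_eq ?_
          rw [abs_mul, abs_of_nonneg (mul_nonneg (sub_nonneg.2 hx.2.le) hN.le), abs_mul,
            abs_of_nonneg (mul_nonneg (sub_nonneg.2 hx.1.le) hN.le)]
      _ = _ := by
          have hd : ∀ x ∈ Set.uIcc ((k : ℝ) / N) (((k : ℝ) + 1) / N),
              HasDerivAt (fun x : ℝ => -((((k : ℝ) + 1) / N - x) ^ 2 * (N * |a k| / 2))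
                + (x - (k : ℝ) / N) ^ 2 * (N * |a (k + 1)| / 2))
              (((((k : ℝ) + 1) / N - x) * N) * |a k| + ((x - (k : ℝ) / N) * N) * |a (k + 1)|)
              x := by
            intro x _
            have h1 := ((((hasDerivAt_id' x).const_sub (((k : ℝ) + 1) / N)).pow 2).mul_const
              (N * |a k| / 2)).neg
            have h2 := (((hasDerivAt_id' x).sub_const ((k : ℝ) / N)).pow 2).mul_const
              (N * |a (k + 1)| / 2)
            refine (h1.add h2).congr_deriv ?_
            norm_num
            ring
          rw [intervalIntegral.integral_eq_sub_of_hasDerivAt hd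
            (Continuous.intervalIntegrable (by fun_prop) _ _)]
          field_simp
          ring
  have hsum := intervalIntegral.sum_integral_adjacent_intervals
    (a := fun k : ℕ => (k : ℝ) / N) (n := N) hint
  simp only [Nat.cast_zero, zero_div, div_self hN.ne'] at hsum
  rw [← hsum]
  refine (Finset.sum_le_sum fun k hk => hcell k (Finset.mem_range.1 hk)).trans_eq ?_
  have up : ∑ j, |a (j + 1)| = ∑ j, |a j| := Equiv.sum_comp (Equiv.addRight 1) fun j => |a j|
  rw [← Finset.mul_sum, ZMod.sum_natCast_range fun j => (|a j| + |a (j + 1)|) / 2,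
    ← Finset.sum_div, Finset.sum_add_distrib, up]
  ring

/-- **`L¹` time continuity of the space-time interpolation.**
Let `W` be the interpolation of a θ-scheme solution that is piecewise linear in `x`
(on each cell `[x_j, x_{j+1})`) and piecewise constant in `t` (on each `[nΔt,(n+1)Δt)`).
Then for `t, τ ≥ 0`,
`∫₀¹ |W(x,t+τ) - W(x,t)| dx ≤ (τ + Δt) ∑_j |z⁰_{j+1} - z⁰_j| + (Δx/2) ∑_j |w⁰_{j+1} - w⁰_j|`,
where `z⁰_j = (w⁰_{j+1} - w⁰_j)/Δx`. -/
theorem interpolation_L1_time_continuity (N : ℕ) [NeZero N] (hN : 2 ≤ N)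
    (θ Δt : ℝ) (hθ0 : 0 ≤ θ) (hθ1 : θ ≤ 1) (hΔt : 0 < Δt)
    (B : ℝ → ℝ) (hB0 : ∀ ξ : ℝ, 0 ≤ B ξ) (hB1 : ∀ ξ : ℝ, B ξ ≤ 1)
    (hCFL : Δt / (gridDx N) ^ 2 * (1 - θ) < 1 / 2)
    (w : ℕ → ZMod N → ℝ) (hw : IsThetaScheme N θ Δt B w)
    (z : ZMod N → ℝ)
    (hz : ∀ j : ZMod N, z j = (w 0 (j + 1) - w 0 j) / gridDx N)
    (W : ℝ → ℝ → ℝ)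
    (hW : ∀ (n : ℕ) (j : ZMod N),
      ∀ x ∈ Set.Ico ((j.val : ℝ) / N) (((j.val : ℝ) + 1) / N),
      ∀ t ∈ Set.Ico ((n : ℝ) * Δt) (((n : ℝ) + 1) * Δt),
      W x t = ((((j.val : ℝ) + 1) / N - x) * N) * w n j
              + ((x - (j.val : ℝ) / N) * N) * w n (j + 1))
    (t τ : ℝ) (ht : 0 ≤ t) (hτ : 0 ≤ τ) :
    ∫ x in (0 : ℝ)..1, |W x (t + τ) - W x t|
      ≤ (τ + Δt) * ∑ j : ZMod N, |z (j + 1) - z j|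
        + (gridDx N / 2) * ∑ j : ZMod N, |w 0 (j + 1) - w 0 j| := by
  have hN0 : (0 : ℝ) < N := by exact_mod_cast NeZero.pos N
  have hdx : 0 < gridDx N := by rw [gridDx]; positivity
  have floor_mem : ∀ s : ℝ, 0 ≤ s →
      s ∈ Set.Ico ((⌊s / Δt⌋₊ : ℝ) * Δt) (((⌊s / Δt⌋₊ : ℝ) + 1) * Δt) := fun s hs =>
    ⟨(le_div_iff₀ hΔt).1 (Nat.floor_le (by positivity)),
      (div_lt_iff₀ hΔt).1 (Nat.lt_floor_add_one _)⟩
  have h1 := floor_mem t ht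
  have h2 := floor_mem (t + τ) (by linarith)
  have hmono : ⌊t / Δt⌋₊ ≤ ⌊(t + τ) / Δt⌋₊ := by
    gcongr
    linarith
  obtain ⟨m, hm⟩ := Nat.exists_eq_add_of_le hmono
  rw [hm] at h2
  set n := ⌊t / Δt⌋₊
  have hmτ : m * Δt ≤ τ + Δt := by
    have a1 := h2.1
    have a2 := h1.2
    push_cast at a1
    linarith
  have hI := integral_abs_le_of_piecewise_linear (fun j => w (n + m) j - w n j)
    (fun x => W x (t + τ) - W x t) fun j x hx => by
      rw [hW _ j x hx _ h2, hW _ j x hx _ h1]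
      ring
  have hS := hw.sum_abs_add_sub_le hθ0 hθ1 hΔt hB0 hB1 hCFL n m
  have hTV : ∑ j, |z (j + 1) - z j| = (∑ j, |secondDiff (w 0) j|) / gridDx N := by
    rw [← Equiv.sum_comp (Equiv.addRight (1 : ZMod N)) fun j => |secondDiff (w 0) j|, Finset.sum_div]
    refine Finset.sum_congr rfl fun j _ => ?_
    rw [hz, hz, ← sub_div, abs_div, abs_of_pos hdx, Equiv.coe_addRight, secondDiff,
      add_sub_cancel_right]
    ring_nf
  have hrest : 0 ≤ (gridDx N / 2) * ∑ j, |w 0 (j + 1) - w 0 j| := by positivity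
  calc ∫ x in (0 : ℝ)..1, |W x (t + τ) - W x t|
      ≤ gridDx N * ∑ j, |w (n + m) j - w n j| := hI
    _ ≤ gridDx N * (m * (Δt / gridDx N ^ 2 * ∑ j, |secondDiff (w 0) j|)) := by gcongr
    _ = m * Δt * ∑ j, |z (j + 1) - z j| := by
        rw [hTV]
        field_simp
    _ ≤ (τ + Δt) * ∑ j, |z (j + 1) - z j| := by gcongr
    _ ≤ _ := le_add_of_nonneg_right hrest
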